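/- Let n > 2 and α ∈ ℝ with n + α - 2 > 0. There exists ε > 0 such that for every q with 2 ≤ q ≤ 2n/(n-1) + 2ε there is a constant c̃ > 0 such that for all φ ∈ C_c^∞(B): ∫_B d^α |∇φ|² λ^{n-2} dx ≥ ((n + α - 2)/2)² ∫_B d^{α-2} φ² λ^n dx + c̃ ( ∫_B d^{((n-2)(q-2) + αq)/2} |φ|^q dx )^{2/q}, where the last integral is with respect to Lebesgue measure dx (no λ factor). -/

import Mathlib

open MeasureTheory

/-- Conformal factor of the Poincaré ball model. -/
noncomputable def lam {n : ℕ} (x : EuclideanSpace ℝ (Fin n)) : ℝ := 2 / (1 - ‖x‖ ^ 2)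

/-- Hyperbolic distance to the origin in the Poincaré ball model. -/
noncomputable def dH {n : ℕ} (x : EuclideanSpace ℝ (Fin n)) : ℝ :=
  Real.log ((1 + ‖x‖) / (1 - ‖x‖))

section RadialCalculus

variable {n : ℕ}

lemma hasFDerivAt_radial {f : ℝ → ℝ} {f' : ℝ} {x : EuclideanSpace ℝ (Fin n)} (hx : x ≠ 0)
    (hf : HasDerivAt f f' ‖x‖) :
    HasFDerivAt (fun y : EuclideanSpace ℝ (Fin n) => f ‖y‖) ((f' / ‖x‖) • innerSL ℝ x) x := by
  have hx' : ‖x‖ ≠ 0 := norm_ne_zero_iff.2 hx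
  have h1 : HasFDerivAt (fun y : EuclideanSpace ℝ (Fin n) => ‖y‖) (‖x‖⁻¹ • innerSL ℝ x) x := by
    have h2 := ((hasStrictFDerivAt_norm_sq x).hasFDerivAt).sqrt (by positivity)
    have h3 : (fun y : EuclideanSpace ℝ (Fin n) => √(‖y‖ ^ 2)) = fun y => ‖y‖ := by
      funext y; exact Real.sqrt_sq (norm_nonneg y)
    rw [h3] at h2
    convert! h2 using 1
    rw [Real.sqrt_sq (norm_nonneg x)]
    ext y
    simp
    field_simp
  have h4 := hf.comp_hasFDerivAt x h1
  convert! h4 using 1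
  ext y
  simp
  ring

lemma gradient_radial_mul {f : ℝ → ℝ} {f' : ℝ} {g : EuclideanSpace ℝ (Fin n) → ℝ}
    {x : EuclideanSpace ℝ (Fin n)} (hx : x ≠ 0)
    (hf : HasDerivAt f f' ‖x‖) (hg : DifferentiableAt ℝ g x) :
    gradient (fun y => f ‖y‖ * g y) x = f ‖x‖ • gradient g x + (f' / ‖x‖ * g x) • x := by
  have h := (hasFDerivAt_radial hx hf).fun_mul hg.hasFDerivAt
  apply (InnerProductSpace.toDual ℝ (EuclideanSpace ℝ (Fin n))).injective
  rw [toDual_gradient, h.fderiv]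
  ext y
  simp [toDual_gradient]
  ring

lemma norm_gradient {g : EuclideanSpace ℝ (Fin n) → ℝ} (x : EuclideanSpace ℝ (Fin n)) :
    ‖gradient g x‖ = ‖fderiv ℝ g x‖ := by
  rw [← toDual_gradient, LinearIsometryEquiv.norm_map]

lemma continuous_gradient {g : EuclideanSpace ℝ (Fin n) → ℝ} (hg : ContDiff ℝ 1 g) :
    Continuous (gradient g) :=
  (InnerProductSpace.toDual ℝ (EuclideanSpace ℝ (Fin n))).symm.continuous.comp
    (hg.continuous_fderiv one_ne_zero)

lemma gradient_eq_zero_of_notMem_tsupport {g : EuclideanSpace ℝ (Fin n) → ℝ}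
    {x : EuclideanSpace ℝ (Fin n)} (hx : x ∉ tsupport g) : gradient g x = 0 := by
  rw [← norm_eq_zero, norm_gradient, norm_eq_zero]
  by_contra h
  exact hx (support_fderiv_subset ℝ h)

lemma integrable_of_continuousOn_tsupport {g F : EuclideanSpace ℝ (Fin n) → ℝ}
    (hg : HasCompactSupport g) (hF : ContinuousOn F (tsupport g))
    (h0 : ∀ x ∉ tsupport g, F x = 0) : Integrable F := by
  rw [← integrableOn_iff_integrable_of_support_subset (s := tsupport g)]
  · exact hF.integrableOn_compact hg
  · intro x hx
    by_contra h
    exact hx (h0 x h)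

/-- Euler's identity integrated: `∫ ⟪∇G, x⟫ = -n ∫ G` for compactly supported `G`. -/
lemma integral_inner_gradient_self {G : EuclideanSpace ℝ (Fin n) → ℝ} (hG : ContDiff ℝ 1 G)
    (hGc : HasCompactSupport G) :
    ∫ x, inner ℝ (gradient G x) x = -(n * ∫ x, G x) := by
  let b := EuclideanSpace.basisFun (Fin n) ℝ
  have hG' := hG.continuous_fderiv one_ne_zero
  have key : ∀ i : Fin n, ∫ x : EuclideanSpace ℝ (Fin n), x i * fderiv ℝ G x (b i)
      = -∫ x, G x := by
    intro i
    have hpr : ∀ x : EuclideanSpace ℝ (Fin n),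
        fderiv ℝ (fun y : EuclideanSpace ℝ (Fin n) => y i) x (b i) = 1 := by
      intro x
      have : HasFDerivAt (fun y : EuclideanSpace ℝ (Fin n) => y i)
        (EuclideanSpace.proj i : EuclideanSpace ℝ (Fin n) →L[ℝ] ℝ) x :=
        (EuclideanSpace.proj i : EuclideanSpace ℝ (Fin n) →L[ℝ] ℝ).hasFDerivAt
      rw [this.fderiv]
      simp [b]
    rw [integral_mul_fderiv_eq_neg_fderiv_mul_of_integrable]
    · simp [hpr]
    · simpa [hpr] using hG.continuous.integrable_of_hasCompactSupport hGc
    · refine integrable_of_continuousOn_tsupport hGc (Continuous.continuousOn (by fun_prop)) ?_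
      intro x hx
      have : fderiv ℝ G x = 0 := by
        by_contra h
        exact hx (support_fderiv_subset ℝ h)
      simp [this]
    · refine integrable_of_continuousOn_tsupport hGc
        (Continuous.continuousOn (by have := hG.continuous; fun_prop)) ?_
      intro x hx
      simp [image_eq_zero_of_notMem_tsupport hx]
    · intro x _; fun_prop
    · intro x _; exact hG.differentiable one_ne_zero x
  have hint : ∀ i : Fin n,
      Integrable (fun x : EuclideanSpace ℝ (Fin n) => x i * fderiv ℝ G x (b i)) := by
    intro i
    refine integrable_of_continuousOn_tsupport hGc (Continuous.continuousOn (by fun_prop)) ?_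
    intro x hx
    have : fderiv ℝ G x = 0 := by
      by_contra h
      exact hx (support_fderiv_subset ℝ h)
    simp [this]
  have hsum : ∀ x : EuclideanSpace ℝ (Fin n), inner ℝ (gradient G x) x
      = ∑ i, x i * fderiv ℝ G x (b i) := by
    intro x
    rw [inner_gradient_left]
    have h := congrArg (fderiv ℝ G x) (b.sum_repr x)
    rw [map_sum] at h
    rw [← h]
    simp [b]
  simp_rw [hsum]
  rw [integral_finsetSum _ (fun i _ => hint i)]
  simp [key]

end RadialCalculus

/-- The open unit ball with its centre removed. -/
def puncturedBall (n : ℕ) : Set (EuclideanSpace ℝ (Fin n)) := {x | 0 < ‖x‖ ∧ ‖x‖ < 1}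

lemma contDiff_radial_mul {n : ℕ} {f : ℝ → ℝ} {g : EuclideanSpace ℝ (Fin n) → ℝ}
    (hf : ∀ r, 0 < r → r < 1 → ContDiffAt ℝ 1 f r) (hg : ContDiff ℝ 1 g)
    (hs : tsupport g ⊆ puncturedBall n) :
    ContDiff ℝ 1 (fun x => f ‖x‖ * g x) := by
  rw [contDiff_iff_contDiffAt]
  intro x
  by_cases hx : x ∈ tsupport g
  · have h := hs hx
    exact ((hf _ h.1 h.2).comp x (contDiffAt_norm ℝ (norm_pos_iff.1 h.1))).mul hg.contDiffAt
  · have : (fun x => f ‖x‖ * g x) =ᶠ[nhds x] fun _ => 0 := by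
      filter_upwards [notMem_tsupport_iff_eventuallyEq.1 hx] with y hy
      simp [hy]
    exact contDiffAt_const.congr_of_eventuallyEq this

/-- Radial integration by parts against `ψ ^ 2`. -/
lemma integral_radial_mul_inner_gradient {n : ℕ} {f f' : ℝ → ℝ}
    {ψ : EuclideanSpace ℝ (Fin n) → ℝ}
    (hf : ∀ r, 0 < r → r < 1 → ContDiffAt ℝ 1 f r)
    (hf' : ∀ r, 0 < r → r < 1 → HasDerivAt f (f' r) r) (hψ : ContDiff ℝ 1 ψ)
    (hc : HasCompactSupport ψ) (hs : tsupport ψ ⊆ puncturedBall n)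
    (hcont : ContinuousOn f' (Set.Ioo 0 1)) :
    ∫ x, f ‖x‖ * (2 * ψ x * inner ℝ (gradient ψ x) x)
      = -∫ x, (n * f ‖x‖ + ‖x‖ * f' ‖x‖) * ψ x ^ 2 := by
  have hG1 := contDiff_radial_mul (n := n) hf hψ hs
  have hcs : HasCompactSupport (fun x => (f ‖x‖ * ψ x) * ψ x) := hc.mul_left
  have h := integral_inner_gradient_self (hG1.mul hψ) hcs
  have hcont1 : ContinuousOn (fun x : EuclideanSpace ℝ (Fin n) => f ‖x‖) (tsupport ψ) := by
    intro x hx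
    have := hs hx
    exact ((hf _ this.1 this.2).continuousAt.comp continuous_norm.continuousAt).continuousWithinAt
  have hcont2 : ContinuousOn (fun x : EuclideanSpace ℝ (Fin n) => f' ‖x‖) (tsupport ψ) :=
    hcont.comp continuous_norm.continuousOn (fun x hx => hs hx)
  have hψc := hψ.continuous
  have hgc := continuous_gradient hψ
  have i1 : Integrable (fun x : EuclideanSpace ℝ (Fin n) =>
      f ‖x‖ * (2 * ψ x * inner ℝ (gradient ψ x) x)) := by
    refine integrable_of_continuousOn_tsupport hc (hcont1.mul (by fun_prop)) ?_
    intro x hx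
    simp [image_eq_zero_of_notMem_tsupport hx]
  have i2 : Integrable (fun x : EuclideanSpace ℝ (Fin n) => ‖x‖ * f' ‖x‖ * ψ x ^ 2) := by
    refine integrable_of_continuousOn_tsupport hc
      ((continuousOn_id.norm.mul hcont2).mul (by fun_prop)) ?_
    intro x hx
    simp [image_eq_zero_of_notMem_tsupport hx]
  have i3 : Integrable (fun x : EuclideanSpace ℝ (Fin n) => n * f ‖x‖ * ψ x ^ 2) := by
    refine integrable_of_continuousOn_tsupport hc
      ((continuousOn_const.mul hcont1).mul (by fun_prop)) ?_
    intro x hx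
    simp [image_eq_zero_of_notMem_tsupport hx]
  have hpt : ∀ x, inner ℝ (gradient (fun x => (f ‖x‖ * ψ x) * ψ x) x) x
      = f ‖x‖ * (2 * ψ x * inner ℝ (gradient ψ x) x) + ‖x‖ * f' ‖x‖ * ψ x ^ 2 := by
    intro x
    by_cases hx : x ∈ tsupport ψ
    · have hx1 := hs hx
      have e : (fun x => (f ‖x‖ * ψ x) * ψ x) = fun x => f ‖x‖ * (ψ x * ψ x) := by
        funext y; ring
      have hd := hψ.differentiable one_ne_zero x
      rw [e, gradient_radial_mul (norm_pos_iff.1 hx1.1) (hf' _ hx1.1 hx1.2) (hd.fun_mul hd)]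
      have e2 : inner ℝ (gradient (fun y => ψ y * ψ y) x) x
          = 2 * ψ x * inner ℝ (gradient ψ x) x := by
        rw [inner_gradient_left, inner_gradient_left,
          (hd.hasFDerivAt.fun_mul hd.hasFDerivAt).fderiv]
        simp
        ring
      rw [inner_add_left, inner_smul_left, inner_smul_left, real_inner_self_eq_norm_sq]
      change f ‖x‖ * inner ℝ (gradient (fun y => ψ y * ψ y) x) x + _ = _
      rw [e2]
      have := hx1.1.ne'
      simp
      field_simp
    · have : x ∉ tsupport (fun x => (f ‖x‖ * ψ x) * ψ x) :=
        fun h => hx (tsupport_mul_subset_right h)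
      rw [gradient_eq_zero_of_notMem_tsupport this, gradient_eq_zero_of_notMem_tsupport hx,
        image_eq_zero_of_notMem_tsupport hx]
      simp
  simp_rw [hpt] at h
  rw [integral_add i1 i2] at h
  have e3 : ∀ x : EuclideanSpace ℝ (Fin n), (n * f ‖x‖ + ‖x‖ * f' ‖x‖) * ψ x ^ 2
      = n * f ‖x‖ * ψ x ^ 2 + ‖x‖ * f' ‖x‖ * ψ x ^ 2 := fun x => by ring
  simp_rw [e3]
  rw [integral_add i3 i2]
  have e4 : ∀ x : EuclideanSpace ℝ (Fin n), n * f ‖x‖ * ψ x ^ 2 = n * ((f ‖x‖ * ψ x) * ψ x) :=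
    fun x => by ring
  simp_rw [e4]
  rw [integral_const_mul]
  linarith

/-- Gagliardo–Nirenberg–Sobolev inequality with real integrals. -/
lemma exists_integral_rpow_le_of_integral_gradient_le {n : ℕ} (hn : 2 < n) :
    ∃ C > (0 : ℝ), ∀ u : EuclideanSpace ℝ (Fin n) → ℝ, ContDiff ℝ 1 u → HasCompactSupport u →
      ∀ t : ℝ, 0 ≤ t → ∫ x, ‖gradient u x‖ ^ 2 ≤ t ^ 2 →
        ∫ x, |u x| ^ (2 * n / ((n : ℝ) - 2)) ≤ C * t ^ (2 * n / ((n : ℝ) - 2)) := by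
  have hn' : (2 : ℝ) < n := by exact_mod_cast hn
  have hn2 : (0 : ℝ) < n - 2 := by linarith
  set p : ℝ := 2 * n / ((n : ℝ) - 2) with hp
  have hp0 : 0 < p := by positivity
  let K : NNReal := eLpNormLESNormFDerivOfEqInnerConst
    (volume : Measure (EuclideanSpace ℝ (Fin n))) ((2 : NNReal) : ℝ)
  refine ⟨((K : ℝ) + 1) ^ p, by positivity, fun u hu huc t ht hle => ?_⟩
  have hS := eLpNorm_le_eLpNorm_fderiv_of_eq_inner
    (volume : Measure (EuclideanSpace ℝ (Fin n))) hu huc (p := 2) (p' := p.toNNReal)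
    (by norm_num) (by simp; omega) (by
      rw [Real.coe_toNNReal _ hp0.le, hp]
      simp
      field_simp)
  have m1 : MemLp u (p.toNNReal : ENNReal) := hu.continuous.memLp_of_hasCompactSupport huc
  have m2 : MemLp (fderiv ℝ u) ((2 : NNReal) : ENNReal) :=
    (hu.continuous_fderiv one_ne_zero).memLp_of_hasCompactSupport (huc.fderiv ℝ)
  rw [m1.eLpNorm_eq_integral_rpow_norm (by simpa using hp0) (by simp),
    m2.eLpNorm_eq_integral_rpow_norm (by simp) (by simp)] at hS
  simp only [ENNReal.coe_toReal, Real.coe_toNNReal _ hp0.le] at hS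
  have e1 : (∫ x, ‖fderiv ℝ u x‖ ^ ((2 : NNReal) : ℝ)) = ∫ x, ‖gradient u x‖ ^ 2 := by
    congr 1
    funext x
    rw [norm_gradient]
    simp
  rw [e1, ← ENNReal.ofReal_coe_nnreal, ← ENNReal.ofReal_mul (by positivity)] at hS
  rw [ENNReal.ofReal_le_ofReal_iff (by positivity)] at hS
  have h2 : (∫ x, ‖gradient u x‖ ^ 2) ^ (((2 : NNReal) : ℝ)⁻¹) ≤ t := by
    calc _ ≤ (t ^ 2) ^ (((2 : NNReal) : ℝ)⁻¹) := by
          apply Real.rpow_le_rpow (by positivity) hle (by positivity)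
      _ = t := by
          rw [← Real.rpow_natCast, ← Real.rpow_mul ht]; simp
  have hI : 0 ≤ ∫ x, |u x| ^ p := by positivity
  have h3 : (∫ x, |u x| ^ p) ^ p⁻¹ ≤ ((K : ℝ) + 1) * t := by
    refine hS.trans ?_
    have : (0 : ℝ) ≤ K := K.2
    exact mul_le_mul (by simp [K]) h2 (by positivity) (by positivity)
  have h4 := Real.rpow_le_rpow (by positivity) h3 hp0.le
  rwa [← Real.rpow_mul hI, inv_mul_cancel₀ hp0.ne', Real.rpow_one,
    Real.mul_rpow (by positivity) ht] at h4

section WeightedInequalities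

variable {n : ℕ} {ψ : EuclideanSpace ℝ (Fin n) → ℝ}

lemma integrable_weight_mul {f : ℝ → ℝ} {F : EuclideanSpace ℝ (Fin n) → ℝ}
    (hf : ContinuousOn f (Set.Ioo 0 1)) (hc : HasCompactSupport ψ)
    (hs : tsupport ψ ⊆ puncturedBall n) (hF : Continuous F)
    (h0 : ∀ x ∉ tsupport ψ, F x = 0) : Integrable (fun x => f ‖x‖ * F x) := by
  refine integrable_of_continuousOn_tsupport hc (ContinuousOn.mul ?_ hF.continuousOn)
    (fun x hx => by simp [h0 x hx])
  exact hf.comp continuous_norm.continuousOn (fun x hx => hs hx)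

lemma continuousOn_rpow_Ioo (s : ℝ) : ContinuousOn (fun r : ℝ => r ^ s) (Set.Ioo 0 1) :=
  fun r hr => (Real.continuousAt_rpow_const r s (Or.inl hr.1.ne')).continuousWithinAt

lemma contDiffAt_rpow_of_pos (s : ℝ) (r : ℝ) (hr : 0 < r) :
    ContDiffAt ℝ 1 (fun r : ℝ => r ^ s) r :=
  Real.contDiffAt_rpow_const_of_ne hr.ne'

lemma integrable_rpow_mul_sq (s : ℝ) (hψ : ContDiff ℝ 1 ψ) (hc : HasCompactSupport ψ)
    (hs : tsupport ψ ⊆ puncturedBall n) : Integrable (fun x => ‖x‖ ^ s * ψ x ^ 2) :=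
  integrable_weight_mul (continuousOn_rpow_Ioo s) hc hs (hψ.continuous.pow 2)
    (fun x hx => by simp [image_eq_zero_of_notMem_tsupport hx])

lemma integrable_rpow_mul_gradient_sq (s : ℝ) (hψ : ContDiff ℝ 1 ψ) (hc : HasCompactSupport ψ)
    (hs : tsupport ψ ⊆ puncturedBall n) :
    Integrable (fun x => ‖x‖ ^ s * ‖gradient ψ x‖ ^ 2) :=
  integrable_weight_mul (continuousOn_rpow_Ioo s) hc hs ((continuous_gradient hψ).norm.pow 2)
    (fun x hx => by simp [gradient_eq_zero_of_notMem_tsupport hx])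

/-- Subcritical weighted Hardy inequality. -/
lemma sq_mul_integral_rpow_le (hψ : ContDiff ℝ 1 ψ) (hc : HasCompactSupport ψ)
    (hs : tsupport ψ ⊆ puncturedBall n) {δ : ℝ} (hδ : 0 < δ) :
    δ ^ 2 * ∫ x, ‖x‖ ^ (2 * δ - n) * ψ x ^ 2
      ≤ ∫ x, ‖x‖ ^ (2 * δ - n + 2) * ‖gradient ψ x‖ ^ 2 := by
  have h := integral_radial_mul_inner_gradient (f := fun r => r ^ (2 * δ - n))
    (f' := fun r => (2 * δ - n) * r ^ (2 * δ - n - 1)) (ψ := ψ)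
    (fun r h _ => contDiffAt_rpow_of_pos _ r h)
    (fun r h _ => Real.hasDerivAt_rpow_const (Or.inl h.ne')) hψ hc hs
    (continuousOn_const.mul (continuousOn_rpow_Ioo _))
  have hgc := continuous_gradient hψ
  have hψc := hψ.continuous
  have e1 : ∀ x : EuclideanSpace ℝ (Fin n),
      (n * ‖x‖ ^ (2 * δ - n) + ‖x‖ * ((2 * δ - n) * ‖x‖ ^ (2 * δ - n - 1))) * ψ x ^ 2
        = 2 * δ * (‖x‖ ^ (2 * δ - n) * ψ x ^ 2) := by
    intro x
    by_cases hx : x ∈ tsupport ψ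
    · have h0 := (hs hx).1
      rw [Real.rpow_sub_one h0.ne']
      field_simp
      ring
    · simp [image_eq_zero_of_notMem_tsupport hx]
  simp_rw [e1] at h
  rw [integral_const_mul] at h
  have i1 := integrable_rpow_mul_sq (2 * δ - n) hψ hc hs
  have i2 := integrable_rpow_mul_gradient_sq (2 * δ - n + 2) hψ hc hs
  have i3 : Integrable (fun x => ‖x‖ ^ (2 * δ - n) * (2 * ψ x * inner ℝ (gradient ψ x) x)) :=
    integrable_weight_mul (continuousOn_rpow_Ioo _) hc hs (by fun_prop)
      (fun x hx => by simp [image_eq_zero_of_notMem_tsupport hx])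
  have hle : -∫ x, ‖x‖ ^ (2 * δ - n) * (2 * ψ x * inner ℝ (gradient ψ x) x)
      ≤ ∫ x, (δ * (‖x‖ ^ (2 * δ - n) * ψ x ^ 2)
        + δ⁻¹ * (‖x‖ ^ (2 * δ - n + 2) * ‖gradient ψ x‖ ^ 2)) := by
    rw [← integral_neg]
    refine integral_mono i3.neg ((i1.const_mul _).add (i2.const_mul _)) fun x => ?_
    by_cases hx : x ∈ tsupport ψ
    · have h0 := (hs hx).1
      have hw : 0 ≤ ‖x‖ ^ (2 * δ - n) := by positivity
      have hin := abs_real_inner_le_norm (gradient ψ x) x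
      have e2 : ‖x‖ ^ (2 * δ - n + 2) = ‖x‖ ^ (2 * δ - n) * ‖x‖ ^ 2 := by
        rw [Real.rpow_add h0]; simp
      have hb : -(2 * ψ x * inner ℝ (gradient ψ x) x)
          ≤ δ * ψ x ^ 2 + δ⁻¹ * (‖x‖ ^ 2 * ‖gradient ψ x‖ ^ 2) := by
        have h5 : (inner ℝ (gradient ψ x) x) ^ 2 ≤ (‖gradient ψ x‖ * ‖x‖) ^ 2 :=
          sq_le_sq' (abs_le.1 hin).1 (abs_le.1 hin).2
        have h6 : 0 ≤ δ⁻¹ * (δ * ψ x + inner ℝ (gradient ψ x) x) ^ 2 := by positivity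
        have h7 : δ⁻¹ * (δ * ψ x + inner ℝ (gradient ψ x) x) ^ 2
            = δ * ψ x ^ 2 + 2 * ψ x * inner ℝ (gradient ψ x) x
              + δ⁻¹ * (inner ℝ (gradient ψ x) x) ^ 2 := by
          field_simp; ring
        have h8 := mul_le_mul_of_nonneg_left h5 (inv_pos.2 hδ).le
        nlinarith
      simp only
      rw [e2]
      nlinarith [mul_le_mul_of_nonneg_left hb hw]
    · simp [image_eq_zero_of_notMem_tsupport hx, gradient_eq_zero_of_notMem_tsupport hx]
  rw [integral_add (i1.const_mul _) (i2.const_mul _), integral_const_mul, integral_const_mul,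
    h] at hle
  set A := ∫ x, ‖x‖ ^ (2 * δ - n) * ψ x ^ 2
  set D := ∫ x, ‖x‖ ^ (2 * δ - n + 2) * ‖gradient ψ x‖ ^ 2
  have h9 : δ * A ≤ δ⁻¹ * D := by linarith
  have h10 := mul_le_mul_of_nonneg_left h9 hδ.le
  rw [← mul_assoc, ← mul_assoc, mul_inv_cancel₀ hδ.ne', one_mul] at h10
  rwa [sq]

lemma integral_rpow_mul_gradient_sq_mono (hψ : ContDiff ℝ 1 ψ) (hc : HasCompactSupport ψ)
    (hs : tsupport ψ ⊆ puncturedBall n) {a b : ℝ} (hab : a ≤ b) :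
    ∫ x, ‖x‖ ^ b * ‖gradient ψ x‖ ^ 2 ≤ ∫ x, ‖x‖ ^ a * ‖gradient ψ x‖ ^ 2 := by
  refine integral_mono (integrable_rpow_mul_gradient_sq b hψ hc hs)
    (integrable_rpow_mul_gradient_sq a hψ hc hs) fun x => ?_
  by_cases hx : x ∈ tsupport ψ
  · have h := hs hx
    exact mul_le_mul_of_nonneg_right
      (Real.rpow_le_rpow_of_exponent_ge h.1 h.2.le hab) (by positivity)
  · simp [gradient_eq_zero_of_notMem_tsupport hx]

/-- Endpoint case of the weighted Sobolev inequality for the weight `‖x‖ ^ (2 - n)`. -/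
lemma exists_integral_weight_rpow_endpoint_le (hn : 2 < n) :
    ∃ C > (0 : ℝ), ∀ ψ : EuclideanSpace ℝ (Fin n) → ℝ, ContDiff ℝ 1 ψ → HasCompactSupport ψ →
      tsupport ψ ⊆ puncturedBall n →
      ∀ t : ℝ, 0 ≤ t → ∫ x, ‖x‖ ^ (2 - n : ℝ) * ‖gradient ψ x‖ ^ 2 ≤ t ^ 2 →
        ∫ x, ‖x‖ ^ (2 - n : ℝ) * |ψ x| ^ (2 * n / ((n : ℝ) - 2))
          ≤ C * t ^ (2 * n / ((n : ℝ) - 2)) := by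
  obtain ⟨C, hC, hS⟩ := exists_integral_rpow_le_of_integral_gradient_le hn
  have hn' : (2 : ℝ) < n := by exact_mod_cast hn
  have hn2 : (0 : ℝ) < n - 2 := by linarith
  set p : ℝ := 2 * n / ((n : ℝ) - 2) with hp
  set δ : ℝ := (n - 2) / n with hδ
  have hδ0 : 0 < δ := by positivity
  set s : ℝ := (2 - n) / 2 + δ with hs
  set M : ℝ := √(2 + 2 * s ^ 2 / δ ^ 2) with hM
  have hM0 : 0 < M := by positivity
  refine ⟨C * M ^ p, by positivity, fun ψ hψ hc hsupp t ht hle => ?_⟩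
  have hu : ContDiff ℝ 1 (fun x => ‖x‖ ^ s * ψ x) :=
    contDiff_radial_mul (f := fun r => r ^ s) (fun r h _ => contDiffAt_rpow_of_pos s r h) hψ hsupp
  have huc : HasCompactSupport (fun x => ‖x‖ ^ s * ψ x) := hc.mul_left
  have hHardy := sq_mul_integral_rpow_le hψ hc hsupp hδ0
  have hmono : ∫ x, ‖x‖ ^ (2 * δ - n + 2) * ‖gradient ψ x‖ ^ 2 ≤ t ^ 2 :=
    (integral_rpow_mul_gradient_sq_mono hψ hc hsupp (by linarith)).trans hle
  have i1 := integrable_rpow_mul_sq (2 * δ - n) hψ hc hsupp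
  have i2 := integrable_rpow_mul_gradient_sq (2 * δ - n + 2) hψ hc hsupp
  have hgrad : ∫ x, ‖gradient (fun x => ‖x‖ ^ s * ψ x) x‖ ^ 2 ≤ (M * t) ^ 2 := by
    have h1 : ∫ x, ‖gradient (fun x => ‖x‖ ^ s * ψ x) x‖ ^ 2
        ≤ ∫ x, (2 * (‖x‖ ^ (2 * δ - n + 2) * ‖gradient ψ x‖ ^ 2)
          + 2 * s ^ 2 * (‖x‖ ^ (2 * δ - n) * ψ x ^ 2)) := by
      refine integral_mono_of_nonneg (Filter.Eventually.of_forall fun x => by positivity)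
        ((i2.const_mul _).add (i1.const_mul _)) (Filter.Eventually.of_forall fun x => ?_)
      by_cases hx : x ∈ tsupport ψ
      · have h0 := hsupp hx
        simp only
        rw [gradient_radial_mul (f := fun r => r ^ s) (norm_pos_iff.1 h0.1)
          (Real.hasDerivAt_rpow_const (Or.inl h0.1.ne')) (hψ.differentiable one_ne_zero x)]
        have h2 : ∀ v w : EuclideanSpace ℝ (Fin n), ‖v + w‖ ^ 2 ≤ 2 * ‖v‖ ^ 2 + 2 * ‖w‖ ^ 2 := by
          intro v w
          nlinarith [parallelogram_law_with_norm ℝ v w, sq_nonneg ‖v - w‖]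
        refine (h2 _ _).trans (le_of_eq ?_)
        rw [norm_smul, norm_smul]
        have e1 : ‖x‖ ^ (2 * δ - n + 2) = (‖x‖ ^ s) ^ 2 := by
          rw [← Real.rpow_mul_natCast h0.1.le]; congr 1; rw [hs]; push_cast; ring
        have e2 : ‖x‖ ^ (2 * δ - n) = (‖x‖ ^ s) ^ 2 / ‖x‖ ^ 2 := by
          rw [← e1, Real.rpow_add h0.1]
          have := h0.1.ne'
          simp
          field_simp
        rw [e1, e2, Real.rpow_sub_one h0.1.ne']
        simp only [mul_pow, Real.norm_eq_abs, sq_abs]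
        have := h0.1.ne'
        field_simp
      · have hx' : x ∉ tsupport (fun x => ‖x‖ ^ s * ψ x) :=
          fun h => hx (tsupport_mul_subset_right h)
        simp [gradient_eq_zero_of_notMem_tsupport hx', gradient_eq_zero_of_notMem_tsupport hx,
          image_eq_zero_of_notMem_tsupport hx]
    refine h1.trans ?_
    rw [integral_add (i2.const_mul _) (i1.const_mul _), integral_const_mul, integral_const_mul,
      mul_pow, hM, Real.sq_sqrt (by positivity)]
    have h3 : ∫ x, ‖x‖ ^ (2 * δ - n) * ψ x ^ 2 ≤ t ^ 2 / δ ^ 2 := by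
      rw [le_div_iff₀ (by positivity)]
      linarith
    have h4 := mul_le_mul_of_nonneg_left h3 (by positivity : 0 ≤ 2 * s ^ 2)
    calc _ ≤ 2 * t ^ 2 + 2 * s ^ 2 * (t ^ 2 / δ ^ 2) := by linarith
      _ = _ := by ring
  have h5 := hS _ hu huc (M * t) (by positivity) hgrad
  rw [Real.mul_rpow hM0.le ht, ← mul_assoc] at h5
  refine le_trans (le_of_eq ?_) h5
  congr 1
  funext x
  by_cases hx : x ∈ tsupport ψ
  · have h0 := (hsupp hx).1
    rw [abs_mul, Real.mul_rpow (abs_nonneg _) (abs_nonneg _), abs_of_pos (Real.rpow_pos_of_pos h0 s),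
      ← Real.rpow_mul h0.le]
    congr 2
    rw [hs, hp, hδ]
    field_simp
    ring
  · have : 0 < p := by positivity
    simp [image_eq_zero_of_notMem_tsupport hx, Real.zero_rpow this.ne']

/-- Weighted Sobolev inequality on the unit ball for the weight `‖x‖ ^ (2 - n)`. -/
lemma exists_integral_weight_rpow_le (hn : 2 < n) :
    ∃ C > (0 : ℝ), ∀ q : ℝ, 2 ≤ q → q ≤ 2 * n / ((n : ℝ) - 2) →
      ∀ ψ : EuclideanSpace ℝ (Fin n) → ℝ, ContDiff ℝ 1 ψ → HasCompactSupport ψ →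
      tsupport ψ ⊆ puncturedBall n →
      ∀ t : ℝ, 0 < t → ∫ x, ‖x‖ ^ (2 - n : ℝ) * ‖gradient ψ x‖ ^ 2 ≤ t ^ 2 →
        ∫ x, ‖x‖ ^ (2 - n : ℝ) * |ψ x| ^ q ≤ C * t ^ q := by
  obtain ⟨C, hC, hS⟩ := exists_integral_weight_rpow_endpoint_le hn
  have hn' : (2 : ℝ) < n := by exact_mod_cast hn
  have hn2 : (0 : ℝ) < n - 2 := by linarith
  set p : ℝ := 2 * n / ((n : ℝ) - 2) with hp
  have hp0 : 0 < p := by positivity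
  refine ⟨1 + C, by positivity, fun q hq2 hqp ψ hψ hc hs t ht hle => ?_⟩
  have h1 := hS ψ hψ hc hs t ht.le hle
  have h2 : ∫ x, ‖x‖ ^ (2 - n : ℝ) * ψ x ^ 2 ≤ t ^ 2 := by
    have h := sq_mul_integral_rpow_le hψ hc hs one_pos
    have h' := (integral_rpow_mul_gradient_sq_mono hψ hc hs
      (by linarith : (2 - n : ℝ) ≤ 2 * 1 - n + 2)).trans hle
    simp only [mul_one, one_pow, one_mul] at h h'
    exact h.trans h'
  have hψc := hψ.continuous
  have ip : Integrable (fun x => ‖x‖ ^ (2 - n : ℝ) * |ψ x| ^ p) :=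
    integrable_weight_mul (continuousOn_rpow_Ioo _) hc hs
      (hψc.abs.rpow_const fun _ => Or.inr hp0.le)
      (fun x hx => by simp [image_eq_zero_of_notMem_tsupport hx, Real.zero_rpow hp0.ne'])
  have i2 := integrable_rpow_mul_sq (2 - n : ℝ) hψ hc hs
  have h3 : ∫ x, ‖x‖ ^ (2 - n : ℝ) * |ψ x| ^ q
      ≤ ∫ x, (t ^ (q - 2) * (‖x‖ ^ (2 - n : ℝ) * ψ x ^ 2)
        + t ^ (q - p) * (‖x‖ ^ (2 - n : ℝ) * |ψ x| ^ p)) := by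
    refine integral_mono_of_nonneg (Filter.Eventually.of_forall fun x => by positivity)
      ((i2.const_mul _).add (ip.const_mul _)) (Filter.Eventually.of_forall fun x => ?_)
    have hpt : |ψ x| ^ q ≤ t ^ (q - 2) * ψ x ^ 2 + t ^ (q - p) * |ψ x| ^ p := by
      rcases (abs_nonneg (ψ x)).eq_or_lt with h0 | h0
      · rw [← h0, Real.zero_rpow (by linarith)]
        positivity
      rcases le_total |ψ x| t with h | h
      · have : |ψ x| ^ q ≤ t ^ (q - 2) * ψ x ^ 2 := by
          calc |ψ x| ^ q = |ψ x| ^ (q - 2) * |ψ x| ^ 2 := by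
                rw [← Real.rpow_add_natCast h0.ne']; congr 1; push_cast; ring
            _ ≤ t ^ (q - 2) * ψ x ^ 2 := by
                rw [sq_abs]
                gcongr
        have : 0 ≤ t ^ (q - p) * |ψ x| ^ p := by positivity
        linarith
      · have : |ψ x| ^ q ≤ t ^ (q - p) * |ψ x| ^ p := by
          calc |ψ x| ^ q = |ψ x| ^ (q - p) * |ψ x| ^ p := by
                rw [← Real.rpow_add h0]; congr 1; ring
            _ ≤ t ^ (q - p) * |ψ x| ^ p := by
                refine mul_le_mul_of_nonneg_right ?_ (by positivity)
                exact Real.rpow_le_rpow_of_nonpos ht h (by linarith)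
        have : 0 ≤ t ^ (q - 2) * ψ x ^ 2 := by positivity
        linarith
    have hw : 0 ≤ ‖x‖ ^ (2 - n : ℝ) := by positivity
    calc _ ≤ ‖x‖ ^ (2 - n : ℝ) * (t ^ (q - 2) * ψ x ^ 2 + t ^ (q - p) * |ψ x| ^ p) :=
          mul_le_mul_of_nonneg_left hpt hw
      _ = _ := by ring
  rw [integral_add (i2.const_mul _) (ip.const_mul _), integral_const_mul, integral_const_mul] at h3
  have h4 := mul_le_mul_of_nonneg_left h2 (by positivity : 0 ≤ t ^ (q - 2))
  have h5 := mul_le_mul_of_nonneg_left h1 (by positivity : 0 ≤ t ^ (q - p))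
  have e1 : t ^ (q - 2) * t ^ 2 = t ^ q := by
    rw [← Real.rpow_add_natCast ht.ne']; congr 1; push_cast; ring
  have e2 : t ^ (q - p) * (C * t ^ p) = C * t ^ q := by
    rw [mul_left_comm, ← Real.rpow_add ht]; congr 2; ring
  rw [e1] at h4
  rw [e2] at h5
  linarith

end WeightedInequalities

section HyperbolicRadial

/-- Hyperbolic distance to the origin as a function of the Euclidean radius. -/
noncomputable def radialDist (r : ℝ) : ℝ := Real.log ((1 + r) / (1 - r))

/-- Conformal factor as a function of the Euclidean radius. -/
noncomputable def radialConf (r : ℝ) : ℝ := 2 / (1 - r ^ 2)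

lemma dH_eq_radialDist {n : ℕ} (x : EuclideanSpace ℝ (Fin n)) : dH x = radialDist ‖x‖ := rfl

lemma lam_eq_radialConf {n : ℕ} (x : EuclideanSpace ℝ (Fin n)) : lam x = radialConf ‖x‖ := rfl

variable {r : ℝ}

lemma radialConf_pos (h0 : 0 ≤ r) (h1 : r < 1) : 0 < radialConf r := by
  have : 0 < 1 - r ^ 2 := by nlinarith
  unfold radialConf
  positivity

lemma two_mul_le_radialDist (h0 : 0 ≤ r) (h1 : r < 1) : 2 * r ≤ radialDist r := by
  have h := Real.sum_range_le_log_div h0 h1 1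
  simp at h
  unfold radialDist
  linarith

lemma radialDist_pos (h0 : 0 < r) (h1 : r < 1) : 0 < radialDist r := by
  linarith [two_mul_le_radialDist h0.le h1]

lemma radialDist_le (h0 : 0 ≤ r) (h1 : r < 1) : radialDist r ≤ radialConf r * r := by
  have hp : 0 < (1 + r) / (1 - r) := div_pos (by linarith) (by linarith)
  have hnn : 0 ≤ radialDist r := by linarith [two_mul_le_radialDist h0 h1]
  have h := Real.self_le_sinh_iff.2 hnn
  unfold radialDist at h ⊢
  rw [Real.sinh_log hp] at h
  refine h.trans (le_of_eq ?_)
  unfold radialConf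
  have h2 : 1 - r ≠ 0 := by linarith
  have h3 : 1 + r ≠ 0 := by linarith
  have h4 : 1 - r ^ 2 ≠ 0 := by nlinarith
  have h5 : 1 - r ^ 2 = (1 - r) * (1 + r) := by ring
  rw [h5]
  field_simp
  ring

lemma hasDerivAt_radialConf (h0 : 0 ≤ r) (h1 : r < 1) :
    HasDerivAt radialConf (radialConf r ^ 2 * r) r := by
  have h : 1 - r ^ 2 ≠ 0 := by nlinarith
  have h2 := (((hasDerivAt_id r).fun_pow 2).const_sub 1).fun_inv h |>.const_mul 2
  unfold radialConf
  simp only [div_eq_mul_inv]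
  convert! h2 using 1
  simp
  field_simp

lemma hasDerivAt_radialDist (h0 : 0 ≤ r) (h1 : r < 1) :
    HasDerivAt radialDist (radialConf r) r := by
  have h2 : 1 - r ≠ 0 := by linarith
  have h3 : 1 + r ≠ 0 := by linarith
  have h := (((hasDerivAt_id r).const_add 1).fun_div ((hasDerivAt_id r).const_sub 1) h2).log
    (div_ne_zero h3 h2)
  unfold radialDist radialConf
  convert! h using 1
  have h5 : 1 - r ^ 2 = (1 - r) * (1 + r) := by ring
  simp only [id]
  rw [h5]
  field_simp
  ring

lemma contDiffAt_radialConf (h0 : 0 ≤ r) (h1 : r < 1) : ContDiffAt ℝ 1 radialConf r := by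
  have h : 1 - r ^ 2 ≠ 0 := by nlinarith
  unfold radialConf
  fun_prop (disch := assumption)

lemma contDiffAt_radialDist (h0 : 0 ≤ r) (h1 : r < 1) : ContDiffAt ℝ 1 radialDist r := by
  have h2 : 1 - r ≠ 0 := by linarith
  have h3 : 1 + r ≠ 0 := by linarith
  have h4 : (1 + r) / (1 - r) ≠ 0 := div_ne_zero h3 h2
  unfold radialDist
  fun_prop (disch := assumption)

lemma contDiffAt_radialDist_rpow (s : ℝ) (h0 : 0 < r) (h1 : r < 1) :
    ContDiffAt ℝ 1 (fun r => radialDist r ^ s) r :=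
  (contDiffAt_radialDist h0.le h1).rpow_const_of_ne (radialDist_pos h0 h1).ne'

lemma contDiffAt_radialConf_rpow (s : ℝ) (h0 : 0 < r) (h1 : r < 1) :
    ContDiffAt ℝ 1 (fun r => radialConf r ^ s) r :=
  (contDiffAt_radialConf h0.le h1).rpow_const_of_ne (radialConf_pos h0.le h1).ne'

lemma continuousOn_radialDist_rpow (s : ℝ) :
    ContinuousOn (fun r => radialDist r ^ s) (Set.Ioo 0 1) :=
  fun _ hr => (contDiffAt_radialDist_rpow s hr.1 hr.2).continuousAt.continuousWithinAt

lemma continuousOn_radialConf_rpow (s : ℝ) :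
    ContinuousOn (fun r => radialConf r ^ s) (Set.Ioo 0 1) :=
  fun _ hr => (contDiffAt_radialConf_rpow s hr.1 hr.2).continuousAt.continuousWithinAt

end HyperbolicRadial

lemma radial_coefficient_le {n a d l r : ℝ} (hn : 1 ≤ n) (hd : 0 < d) (hr : 0 < r) (hr1 : r < 1)
    (hl : l = 2 / (1 - r ^ 2)) (h : 2 * r ≤ d) :
    (n + a - 2) * (l * r / d) ≤ n - 1 + (a - 1) * (l * r / d) + (n - 1) * (l * r ^ 2) := by
  have h1 : 0 < 1 - r ^ 2 := by nlinarith
  have h2 : l * r / d ≤ 1 + l * r ^ 2 := by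
    rw [div_le_iff₀ hd, hl]
    have : (1 + 2 / (1 - r ^ 2) * r ^ 2) * d - 2 / (1 - r ^ 2) * r
        = ((1 + r ^ 2) * d - 2 * r) / (1 - r ^ 2) := by
      field_simp; ring
    have h3 : 0 ≤ ((1 + r ^ 2) * d - 2 * r) / (1 - r ^ 2) :=
      div_nonneg (by nlinarith [mul_pos (pow_pos hr 2) hd]) h1.le
    linarith
  nlinarith [mul_le_mul_of_nonneg_left h2 (by linarith : 0 ≤ n - 1)]

/-- Ground state representation: the Hardy deficit controls the weighted Dirichlet energy of
`d ^ β * φ`. -/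
lemma integral_weight_gradient_le_hardy_deficit {n : ℕ} (hn : 2 < n) (α : ℝ)
    (hα : 0 < (n : ℝ) + α - 2) {φ : EuclideanSpace ℝ (Fin n) → ℝ} (hφ : ContDiff ℝ 1 φ)
    (hc : HasCompactSupport φ) (hs : tsupport φ ⊆ puncturedBall n) :
    (((n : ℝ) + α - 2) / 2) ^ 2 * (∫ x, dH x ^ (α - 2) * φ x ^ 2 * lam x ^ (n : ℝ))
      + ∫ x, ‖x‖ ^ (2 - n : ℝ) *
        ‖gradient (fun x => radialDist ‖x‖ ^ (((n : ℝ) + α - 2) / 2) * φ x) x‖ ^ 2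
      ≤ ∫ x, dH x ^ α * ‖gradient φ x‖ ^ 2 * lam x ^ ((n : ℝ) - 2) := by
  have hn' : (2 : ℝ) < n := by exact_mod_cast hn
  set β : ℝ := ((n : ℝ) + α - 2) / 2 with hβ
  have hβ0 : 0 < β := by positivity
  let m : ℝ → ℝ := fun r => radialDist r ^ (α - 1) * radialConf r ^ ((n : ℝ) - 1) * r⁻¹
  let m' : ℝ → ℝ := fun r => m r *
    ((α - 1) * (radialConf r / radialDist r) + (n - 1) * (radialConf r * r) - r⁻¹)
  have hm : ∀ r, 0 < r → r < 1 → ContDiffAt ℝ 1 m r := fun r h0 h1 =>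
    ((contDiffAt_radialDist_rpow _ h0 h1).mul (contDiffAt_radialConf_rpow _ h0 h1)).mul
      (contDiffAt_id.inv h0.ne')
  have hm' : ∀ r, 0 < r → r < 1 → HasDerivAt m (m' r) r := by
    intro r h0 h1
    have hd := radialDist_pos h0 h1
    have hl := radialConf_pos h0.le h1
    have h := (((hasDerivAt_radialDist h0.le h1).rpow_const (p := α - 1) (Or.inl hd.ne')).fun_mul
      ((hasDerivAt_radialConf h0.le h1).rpow_const (p := (n : ℝ) - 1) (Or.inl hl.ne'))).fun_mul
      (hasDerivAt_inv h0.ne')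
    convert! h using 1
    simp only [m', m]
    rw [Real.rpow_sub_one hd.ne' (α - 1), Real.rpow_sub_one hl.ne' ((n : ℝ) - 1)]
    field_simp
    ring
  have hdc : ContinuousOn radialDist (Set.Ioo 0 1) := fun r hr =>
    (contDiffAt_radialDist hr.1.le hr.2).continuousAt.continuousWithinAt
  have hlc : ContinuousOn radialConf (Set.Ioo 0 1) := fun r hr =>
    (contDiffAt_radialConf hr.1.le hr.2).continuousAt.continuousWithinAt
  have hinv : ContinuousOn (fun r : ℝ => r⁻¹) (Set.Ioo 0 1) :=
    continuousOn_id.inv₀ fun r hr => hr.1.ne'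
  have hmc : ContinuousOn m (Set.Ioo 0 1) := fun r hr =>
    (hm r hr.1 hr.2).continuousAt.continuousWithinAt
  have hmc' : ContinuousOn m' (Set.Ioo 0 1) :=
    hmc.mul (((continuousOn_const.mul (hlc.div hdc fun r hr => (radialDist_pos hr.1 hr.2).ne')).add
      (continuousOn_const.mul (hlc.mul continuousOn_id))).sub hinv)
  have hparts := integral_radial_mul_inner_gradient hm hm' hφ hc hs hmc'
  have hφc := hφ.continuous
  have hgc := continuous_gradient hφ
  have iI : Integrable (fun x => dH x ^ α * ‖gradient φ x‖ ^ 2 * lam x ^ ((n : ℝ) - 2)) := by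
    have := integrable_weight_mul ((continuousOn_radialDist_rpow α).mul
      (continuousOn_radialConf_rpow ((n : ℝ) - 2))) hc hs (hgc.norm.pow 2)
      (fun x hx => by simp [gradient_eq_zero_of_notMem_tsupport hx])
    refine this.congr (Filter.Eventually.of_forall fun x => ?_)
    simp only [dH_eq_radialDist, lam_eq_radialConf, Pi.mul_apply, Pi.pow_apply]
    ring
  have iJ : Integrable (fun x => dH x ^ (α - 2) * φ x ^ 2 * lam x ^ (n : ℝ)) := by
    have := integrable_weight_mul ((continuousOn_radialDist_rpow (α - 2)).mul
      (continuousOn_radialConf_rpow n)) hc hs (hφc.pow 2)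
      (fun x hx => by simp [image_eq_zero_of_notMem_tsupport hx])
    refine this.congr (Filter.Eventually.of_forall fun x => ?_)
    simp only [dH_eq_radialDist, lam_eq_radialConf, Pi.mul_apply, Pi.pow_apply]
    ring
  have iM : Integrable (fun x => m ‖x‖ * (2 * φ x * inner ℝ (gradient φ x) x)) :=
    integrable_weight_mul hmc hc hs (by fun_prop)
      (fun x hx => by simp [image_eq_zero_of_notMem_tsupport hx])
  have iM' : Integrable (fun x => (n * m ‖x‖ + ‖x‖ * m' ‖x‖) * φ x ^ 2) :=
    integrable_weight_mul ((continuousOn_const.mul hmc).add (continuousOn_id.mul hmc')) hc hs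
      (hφc.pow 2) (fun x hx => by simp [image_eq_zero_of_notMem_tsupport hx])
  have hcoef : 2 * β * (∫ x, dH x ^ (α - 2) * φ x ^ 2 * lam x ^ (n : ℝ))
      ≤ ∫ x, (n * m ‖x‖ + ‖x‖ * m' ‖x‖) * φ x ^ 2 := by
    rw [← integral_const_mul]
    refine integral_mono (iJ.const_mul _) iM' fun x => ?_
    by_cases hx : x ∈ tsupport φ
    · obtain ⟨h0, h1⟩ := hs hx
      have hd := radialDist_pos h0 h1
      have hl := radialConf_pos h0.le h1
      have hle := radial_coefficient_le (n := n) (a := α) (by linarith) hd h0 h1 rfl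
        (two_mul_le_radialDist h0.le h1)
      simp only [dH_eq_radialDist, lam_eq_radialConf]
      set d := radialDist ‖x‖ with hdd
      change _ * (_ / (1 - ‖x‖ ^ 2) * _ / _) ≤ _ + _ * (_ / (1 - ‖x‖ ^ 2) * _ / _) +
        _ * (_ / (1 - ‖x‖ ^ 2) * _) at hle
      rw [show 2 / (1 - ‖x‖ ^ 2) = radialConf ‖x‖ from rfl] at hle
      set l := radialConf ‖x‖ with hll
      have hm0 : 0 < m ‖x‖ := by
        simp only [m, ← hdd, ← hll]; positivity
      have e1 : m ‖x‖ * (l * ‖x‖ / d) = d ^ (α - 2) * l ^ (n : ℝ) := by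
        simp only [m, ← hdd, ← hll]
        rw [show α - 2 = α - 1 - 1 by ring, Real.rpow_sub_one hd.ne' (α - 1),
          Real.rpow_sub_one hl.ne']
        field_simp
      have e2 : n * m ‖x‖ + ‖x‖ * m' ‖x‖
          = m ‖x‖ * (n - 1 + (α - 1) * (l * ‖x‖ / d) + (n - 1) * (l * ‖x‖ ^ 2)) := by
        simp only [m', ← hdd, ← hll]
        field_simp
        ring
      have h3 := mul_le_mul_of_nonneg_left hle hm0.le
      rw [← e2, mul_left_comm, e1] at h3
      have h4 := mul_le_mul_of_nonneg_right h3 (sq_nonneg (φ x))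
      calc _ = ((n : ℝ) + α - 2) * (d ^ (α - 2) * l ^ (n : ℝ)) * φ x ^ 2 := by rw [hβ]; ring
        _ ≤ _ := h4
    · simp [image_eq_zero_of_notMem_tsupport hx]
  have hmain : ∫ x, ‖x‖ ^ (2 - n : ℝ) *
        ‖gradient (fun x => radialDist ‖x‖ ^ β * φ x) x‖ ^ 2
      ≤ ∫ x, (dH x ^ α * ‖gradient φ x‖ ^ 2 * lam x ^ ((n : ℝ) - 2)
        + β * (m ‖x‖ * (2 * φ x * inner ℝ (gradient φ x) x))
        + β ^ 2 * (dH x ^ (α - 2) * φ x ^ 2 * lam x ^ (n : ℝ))) := by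
    refine integral_mono_of_nonneg (Filter.Eventually.of_forall fun x => by positivity)
      ((iI.add (iM.const_mul _)).add (iJ.const_mul _)) (Filter.Eventually.of_forall fun x => ?_)
    by_cases hx : x ∈ tsupport φ
    · obtain ⟨h0, h1⟩ := hs hx
      have hd := radialDist_pos h0 h1
      have hl := radialConf_pos h0.le h1
      have hdl := radialDist_le h0.le h1
      simp only [dH_eq_radialDist, lam_eq_radialConf]
      have hw : ‖x‖ ^ (2 - n : ℝ) ≤ radialDist ‖x‖ ^ (2 - n : ℝ) *
          radialConf ‖x‖ ^ ((n : ℝ) - 2) := by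
        have : (radialConf ‖x‖ * ‖x‖) ^ (2 - n : ℝ) ≤ radialDist ‖x‖ ^ (2 - n : ℝ) :=
          Real.rpow_le_rpow_of_nonpos hd hdl (by linarith)
        rw [Real.mul_rpow hl.le h0.le] at this
        have h3 := mul_le_mul_of_nonneg_right this
          (by positivity : 0 ≤ radialConf ‖x‖ ^ ((n : ℝ) - 2))
        refine le_trans (le_of_eq ?_) h3
        rw [mul_right_comm, ← Real.rpow_add hl]
        simp
      refine (mul_le_mul_of_nonneg_right hw (by positivity)).trans (le_of_eq ?_)
      rw [gradient_radial_mul (f := fun r => radialDist r ^ β) (norm_pos_iff.1 h0)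
        ((hasDerivAt_radialDist h0.le h1).rpow_const (Or.inl hd.ne'))
        (hφ.differentiable one_ne_zero x), norm_add_sq_real, norm_smul, norm_smul,
        inner_smul_left, inner_smul_right]
      simp only [mul_pow, Real.norm_eq_abs, sq_abs, m]
      set d := radialDist ‖x‖
      set l := radialConf ‖x‖
      set i := inner ℝ (gradient φ x) x
      have a1 : d ^ α = d ^ (2 - n : ℝ) * (d ^ β) ^ 2 := by
        rw [← Real.rpow_mul_natCast hd.le, ← Real.rpow_add hd]
        congr 1; rw [hβ]; push_cast; ring
      have a2 : d ^ (α - 1) = d ^ α / d := Real.rpow_sub_one hd.ne' α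
      have a3 : d ^ (α - 2) = d ^ α / d ^ 2 := by
        rw [Real.rpow_sub hd]; simp
      have a4 : l ^ ((n : ℝ) - 1) = l ^ ((n : ℝ) - 2) * l := by
        rw [← Real.rpow_add_one hl.ne']; congr 1; ring
      have a5 : l ^ (n : ℝ) = l ^ ((n : ℝ) - 2) * l ^ 2 := by
        rw [← Real.rpow_add_natCast hl.ne']; congr 1; push_cast; ring
      rw [a2, a3, a4, a5, a1, Real.rpow_sub_one hd.ne']
      simp
      field_simp
    · have hx' : x ∉ tsupport (fun x => radialDist ‖x‖ ^ β * φ x) :=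
        fun h => hx (tsupport_mul_subset_right h)
      simp [gradient_eq_zero_of_notMem_tsupport hx', gradient_eq_zero_of_notMem_tsupport hx,
        image_eq_zero_of_notMem_tsupport hx]
  have iIM : Integrable (fun x => dH x ^ α * ‖gradient φ x‖ ^ 2 * lam x ^ ((n : ℝ) - 2)
      + β * (m ‖x‖ * (2 * φ x * inner ℝ (gradient φ x) x))) := iI.add (iM.const_mul _)
  rw [integral_add iIM (iJ.const_mul _), integral_add iI (iM.const_mul _), integral_const_mul,
    integral_const_mul, hparts] at hmain
  have := mul_le_mul_of_nonneg_left hcoef hβ0.le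
  nlinarith

lemma hardy_sobolev_of_tsupport_subset_puncturedBall {n : ℕ} (hn : 2 < n) (α : ℝ)
    (hα : 0 < (n : ℝ) + α - 2) {q : ℝ} (hq2 : 2 ≤ q) (hq : q ≤ 2 * n / ((n : ℝ) - 2)) :
    ∃ c > (0 : ℝ), ∀ φ : EuclideanSpace ℝ (Fin n) → ℝ, ContDiff ℝ 1 φ → HasCompactSupport φ →
      tsupport φ ⊆ puncturedBall n →
      (((n : ℝ) + α - 2) / 2) ^ 2 * (∫ x, dH x ^ (α - 2) * φ x ^ 2 * lam x ^ (n : ℝ))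
        + c * (∫ x, dH x ^ ((((n : ℝ) - 2) * (q - 2) + α * q) / 2) * |φ x| ^ q) ^ (2 / q)
        ≤ ∫ x, dH x ^ α * ‖gradient φ x‖ ^ 2 * lam x ^ ((n : ℝ) - 2) := by
  obtain ⟨C, hC, hS⟩ := exists_integral_weight_rpow_le hn
  have hn' : (2 : ℝ) < n := by exact_mod_cast hn
  have hq0 : 0 < q := by linarith
  set β : ℝ := ((n : ℝ) + α - 2) / 2 with hβ
  refine ⟨(C ^ (2 / q))⁻¹, by positivity, fun φ hφ hc hs => ?_⟩
  have hG := integral_weight_gradient_le_hardy_deficit hn α hα hφ hc hs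
  rw [← hβ] at hG
  set ψ : EuclideanSpace ℝ (Fin n) → ℝ := fun x => radialDist ‖x‖ ^ β * φ x with hψ_def
  have hψ : ContDiff ℝ 1 ψ := contDiff_radial_mul (f := fun r => radialDist r ^ β)
    (fun r h0 h1 => contDiffAt_radialDist_rpow β h0 h1) hφ hs
  have hψc : HasCompactSupport ψ := hc.mul_left
  have hψs : tsupport ψ ⊆ puncturedBall n := (tsupport_mul_subset_right).trans hs
  set J := ∫ x, dH x ^ (α - 2) * φ x ^ 2 * lam x ^ (n : ℝ)
  set I := ∫ x, dH x ^ α * ‖gradient φ x‖ ^ 2 * lam x ^ ((n : ℝ) - 2)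
  set D := ∫ x, ‖x‖ ^ (2 - n : ℝ) * ‖gradient ψ x‖ ^ 2 with hD
  set S := ∫ x, dH x ^ ((((n : ℝ) - 2) * (q - 2) + α * q) / 2) * |φ x| ^ q with hSdef
  have hD0 : 0 ≤ D := integral_nonneg fun x => by positivity
  have hpt : ∀ x, 0 ≤ dH x ^ ((((n : ℝ) - 2) * (q - 2) + α * q) / 2) * |φ x| ^ q ∧
      dH x ^ ((((n : ℝ) - 2) * (q - 2) + α * q) / 2) * |φ x| ^ q
        ≤ ‖x‖ ^ (2 - n : ℝ) * |ψ x| ^ q := by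
    intro x
    by_cases hx : x ∈ tsupport φ
    · obtain ⟨h0, h1⟩ := hs hx
      have hd := radialDist_pos h0 h1
      rw [dH_eq_radialDist]
      refine ⟨by positivity, ?_⟩
      have h2 : radialDist ‖x‖ ^ (2 - n : ℝ) ≤ ‖x‖ ^ (2 - n : ℝ) :=
        Real.rpow_le_rpow_of_nonpos h0 (by linarith [two_mul_le_radialDist h0.le h1])
          (by linarith)
      simp only [hψ_def]
      rw [abs_mul, Real.mul_rpow (abs_nonneg _) (abs_nonneg _),
        abs_of_pos (Real.rpow_pos_of_pos hd β), ← Real.rpow_mul hd.le, ← mul_assoc]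
      refine mul_le_mul_of_nonneg_right ?_ (by positivity)
      refine le_trans (le_of_eq ?_) (mul_le_mul_of_nonneg_right h2 (by positivity))
      rw [← Real.rpow_add hd]
      congr 1
      rw [hβ]
      ring
    · simp [hψ_def, image_eq_zero_of_notMem_tsupport hx, Real.zero_rpow hq0.ne']
  have iψ : Integrable (fun x => ‖x‖ ^ (2 - n : ℝ) * |ψ x| ^ q) :=
    integrable_weight_mul (continuousOn_rpow_Ioo _) hψc hψs
      (hψ.continuous.abs.rpow_const fun _ => Or.inr hq0.le)
      (fun x hx => by simp [image_eq_zero_of_notMem_tsupport hx, Real.zero_rpow hq0.ne'])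
  have hS0 : 0 ≤ S := integral_nonneg fun x => (hpt x).1
  have hSle : S ≤ ∫ x, ‖x‖ ^ (2 - n : ℝ) * |ψ x| ^ q :=
    integral_mono_of_nonneg (Filter.Eventually.of_forall fun x => (hpt x).1) iψ
      (Filter.Eventually.of_forall fun x => (hpt x).2)
  have hkey : (C ^ (2 / q))⁻¹ * S ^ (2 / q) ≤ D := by
    refine le_of_forall_pos_le_add fun κ hκ => ?_
    have ht : 0 < √(D + κ) := Real.sqrt_pos.2 (by linarith)
    have h1 := hSle.trans (hS q hq2 hq ψ hψ hψc hψs _ ht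
      (by rw [Real.sq_sqrt (by linarith)]; linarith))
    have h2 := Real.rpow_le_rpow hS0 h1 (by positivity : 0 ≤ 2 / q)
    rw [Real.mul_rpow hC.le (by positivity), ← Real.rpow_mul ht.le,
      mul_div_cancel₀ _ hq0.ne', Real.rpow_two, Real.sq_sqrt (by linarith)] at h2
    rw [inv_mul_le_iff₀ (by positivity)]
    exact h2
  linarith

section Approximation

variable {n : ℕ}

lemma integrableOn_norm_rpow_ball (hn : 0 < n) {s : ℝ} (hs : -(n : ℝ) < s) :
    IntegrableOn (fun x : EuclideanSpace ℝ (Fin n) => ‖x‖ ^ s) (Metric.ball 0 1) := by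
  have : NeZero n := ⟨hn.ne'⟩
  rw [integrableOn_fun_norm_addHaar volume (f := fun r : ℝ => r ^ s)]
  have h := (intervalIntegral.intervalIntegrable_rpow' (a := 0) (b := 1)
    (r := s + (n - 1)) (by linarith))
  rw [intervalIntegrable_iff_integrableOn_Ioo_of_le zero_le_one] at h
  refine h.congr_fun (fun r hr => ?_) measurableSet_Ioo
  simp only [finrank_euclideanSpace, Fintype.card_fin, smul_eq_mul]
  rw [add_comm, Real.rpow_add hr.1, ← Real.rpow_natCast, Nat.cast_sub (by omega)]
  simp

lemma measurable_dH : Measurable (dH : EuclideanSpace ℝ (Fin n) → ℝ) := by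
  unfold dH
  fun_prop

lemma measurable_lam : Measurable (lam : EuclideanSpace ℝ (Fin n) → ℝ) := by
  unfold lam
  fun_prop

lemma measurable_dH_rpow_mul {F : EuclideanSpace ℝ (Fin n) → ℝ} (hF : Continuous F) (s t : ℝ) :
    Measurable (fun x => dH x ^ s * F x * lam x ^ t) :=
  ((measurable_dH.pow_const s).mul hF.measurable).mul (measurable_lam.pow_const t)

lemma continuousOn_lam_rpow (t : ℝ) :
    ContinuousOn (fun x : EuclideanSpace ℝ (Fin n) => lam x ^ t) (Metric.ball 0 1) := by
  intro x hx
  have h1 : ‖x‖ < 1 := by simpa using hx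
  have h := (contDiffAt_radialConf (norm_nonneg x) h1).continuousAt.comp
    continuous_norm.continuousAt
  exact (ContinuousAt.rpow_const h
    (Or.inl (radialConf_pos (norm_nonneg x) h1).ne')).continuousWithinAt

lemma dH_nonneg {x : EuclideanSpace ℝ (Fin n)} (hx : ‖x‖ < 1) : 0 ≤ dH x := by
  have := two_mul_le_radialDist (norm_nonneg x) hx
  rw [dH_eq_radialDist]
  linarith [norm_nonneg x]

lemma dH_rpow_le {x : EuclideanSpace ℝ (Fin n)} (h0 : 0 < ‖x‖) (h1 : ‖x‖ < 1) (s : ℝ) :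
    dH x ^ s ≤ ‖x‖ ^ s * (1 + lam x ^ s) := by
  have hd := radialDist_pos h0 h1
  have hl := radialConf_pos h0.le h1
  rw [dH_eq_radialDist, lam_eq_radialConf]
  have p1 : 0 < ‖x‖ ^ s := by positivity
  have p2 : 0 < radialConf ‖x‖ ^ s := by positivity
  rcases le_total 0 s with hs | hs
  · have h := Real.rpow_le_rpow hd.le (radialDist_le h0.le h1) hs
    rw [Real.mul_rpow hl.le h0.le] at h
    nlinarith
  · have h := Real.rpow_le_rpow_of_nonpos h0
      (by linarith [two_mul_le_radialDist h0.le h1] : ‖x‖ ≤ radialDist ‖x‖) hs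
    nlinarith [mul_pos p1 p2]

lemma ae_norm_pos (hn : 0 < n) : ∀ᵐ x : EuclideanSpace ℝ (Fin n), 0 < ‖x‖ := by
  have : NeZero n := ⟨hn.ne'⟩
  filter_upwards [compl_mem_ae_iff.2 (measure_singleton (0 : EuclideanSpace ℝ (Fin n)))] with x hx
  exact norm_pos_iff.2 hx

lemma integrable_dH_rpow_mul (hn : 0 < n) {s t : ℝ} (hs : -(n : ℝ) < s)
    {φ F : EuclideanSpace ℝ (Fin n) → ℝ} (hc : HasCompactSupport φ)
    (hsupp : tsupport φ ⊆ Metric.ball 0 1) (hF : Continuous F) (h0 : ∀ x ∉ tsupport φ, F x = 0) :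
    Integrable (fun x => dH x ^ s * F x * lam x ^ t) := by
  have hcont : ContinuousOn (fun x => (1 + lam x ^ s) * F x * lam x ^ t) (tsupport φ) :=
    ((continuousOn_const.add ((continuousOn_lam_rpow s).mono hsupp)).mul hF.continuousOn).mul
      ((continuousOn_lam_rpow t).mono hsupp)
  obtain ⟨B, hB⟩ := hc.exists_bound_of_continuousOn hcont
  have hi : Integrable (Set.indicator (Metric.ball 0 1)
      (fun x : EuclideanSpace ℝ (Fin n) => ‖x‖ ^ s * |B|)) := by
    have h : IntegrableOn (fun x : EuclideanSpace ℝ (Fin n) => ‖x‖ ^ s * |B|) (Metric.ball 0 1) :=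
      (integrableOn_norm_rpow_ball hn hs).mul_const _
    exact h.integrable_indicator measurableSet_ball
  refine hi.mono' (measurable_dH_rpow_mul hF s t).aestronglyMeasurable ?_
  filter_upwards [ae_norm_pos hn] with x hx
  by_cases hxs : x ∈ tsupport φ
  · have hb := hsupp hxs
    have h1 : ‖x‖ < 1 := by simpa using hb
    rw [Set.indicator_of_mem hb]
    have hb' := (hB x hxs).trans (le_abs_self B)
    rw [mul_assoc, norm_mul] at hb' ⊢
    have hl : 0 < lam x := radialConf_pos hx.le h1
    have hd := dH_nonneg h1
    have hle := dH_rpow_le hx h1 s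
    rw [Real.norm_of_nonneg (by positivity)] at hb' ⊢
    calc dH x ^ s * ‖F x * lam x ^ t‖ ≤ ‖x‖ ^ s * (1 + lam x ^ s) * ‖F x * lam x ^ t‖ :=
          mul_le_mul_of_nonneg_right hle (norm_nonneg _)
      _ = ‖x‖ ^ s * ((1 + lam x ^ s) * ‖F x * lam x ^ t‖) := by ring
      _ ≤ ‖x‖ ^ s * |B| := mul_le_mul_of_nonneg_left hb' (by positivity)
  · rw [h0 x hxs]
    simp only [mul_zero, zero_mul, norm_zero]
    exact Set.indicator_nonneg (fun z _ => by positivity) x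

/-- A smooth function vanishing on the unit ball and equal to one far away. -/
noncomputable def outerCutoff (y : EuclideanSpace ℝ (Fin n)) : ℝ :=
  Real.smoothTransition (‖y‖ ^ 2 - 1)

lemma contDiff_outerCutoff : ContDiff ℝ 1 (outerCutoff (n := n)) :=
  Real.smoothTransition.contDiff.comp ((contDiff_norm_sq ℝ).sub contDiff_const)

lemma outerCutoff_nonneg (y : EuclideanSpace ℝ (Fin n)) : 0 ≤ outerCutoff y :=
  Real.smoothTransition.nonneg _

lemma outerCutoff_le_one (y : EuclideanSpace ℝ (Fin n)) : outerCutoff y ≤ 1 :=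
  Real.smoothTransition.le_one _

lemma outerCutoff_eq_zero {y : EuclideanSpace ℝ (Fin n)} (hy : ‖y‖ ≤ 1) : outerCutoff y = 0 :=
  Real.smoothTransition.zero_of_nonpos (by nlinarith [norm_nonneg y])

lemma outerCutoff_eq_one {y : EuclideanSpace ℝ (Fin n)} (hy : 2 ≤ ‖y‖) : outerCutoff y = 1 :=
  Real.smoothTransition.one_of_one_le (by nlinarith)

lemma outerCutoff_eventuallyEq_one {y : EuclideanSpace ℝ (Fin n)} (hy : 2 < ‖y‖) :
    outerCutoff =ᶠ[nhds y] fun _ => 1 := by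
  filter_upwards [continuous_norm.continuousAt.eventually (lt_mem_nhds hy)] with z hz
  exact outerCutoff_eq_one hz.le

lemma exists_norm_gradient_outerCutoff_mul_le :
    ∃ M : ℝ, ∀ y : EuclideanSpace ℝ (Fin n), ‖gradient outerCutoff y‖ * ‖y‖ ≤ M := by
  have hcont : Continuous fun y : EuclideanSpace ℝ (Fin n) => ‖gradient outerCutoff y‖ * ‖y‖ := by
    have := continuous_gradient (contDiff_outerCutoff (n := n))
    fun_prop
  obtain ⟨M, hM⟩ := hcont.bounded_above_of_compact_support (by
    refine HasCompactSupport.of_support_subset_isCompact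
      (isCompact_closedBall (0 : EuclideanSpace ℝ (Fin n)) 2) fun y hy => ?_
    by_contra h
    have hy2 : 2 < ‖y‖ := by simpa using h
    apply hy
    simp only
    rw [norm_gradient, (outerCutoff_eventuallyEq_one hy2).fderiv_eq]
    simp)
  exact ⟨M, fun y => (Real.le_norm_self _).trans (hM y)⟩

/-- The function `φ` cut off near the origin at scale `1 / R`. -/
noncomputable def cutNearOrigin (R : ℝ) (φ : EuclideanSpace ℝ (Fin n) → ℝ)
    (x : EuclideanSpace ℝ (Fin n)) : ℝ := outerCutoff (R • x) * φ x

variable {R : ℝ} {φ : EuclideanSpace ℝ (Fin n) → ℝ}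

lemma contDiff_cutNearOrigin (hφ : ContDiff ℝ 1 φ) : ContDiff ℝ 1 (cutNearOrigin R φ) :=
  (contDiff_outerCutoff.comp (contDiff_const_smul R)).mul hφ

lemma tsupport_cutNearOrigin_subset (R : ℝ) (φ : EuclideanSpace ℝ (Fin n) → ℝ) :
    tsupport (cutNearOrigin R φ) ⊆ tsupport φ := tsupport_mul_subset_right

lemma tsupport_cutNearOrigin_subset_puncturedBall (hR : 0 < R)
    (hs : tsupport φ ⊆ Metric.ball 0 1) : tsupport (cutNearOrigin R φ) ⊆ puncturedBall n := by
  intro x hx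
  refine ⟨norm_pos_iff.2 ?_, by simpa using hs (tsupport_cutNearOrigin_subset R φ hx)⟩
  rintro rfl
  revert hx
  rw [imp_false, notMem_tsupport_iff_eventuallyEq]
  filter_upwards [Metric.ball_mem_nhds (0 : EuclideanSpace ℝ (Fin n)) (inv_pos.2 hR)] with y hy
  have hy' : ‖y‖ < R⁻¹ := by simpa using hy
  have : ‖R • y‖ ≤ 1 := by
    rw [norm_smul, Real.norm_of_nonneg hR.le]
    calc R * ‖y‖ ≤ R * R⁻¹ := mul_le_mul_of_nonneg_left hy'.le hR.le
      _ = 1 := mul_inv_cancel₀ hR.ne'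
  simp [cutNearOrigin, outerCutoff_eq_zero this]

lemma abs_cutNearOrigin_le (R : ℝ) (φ : EuclideanSpace ℝ (Fin n) → ℝ)
    (x : EuclideanSpace ℝ (Fin n)) : |cutNearOrigin R φ x| ≤ |φ x| := by
  rw [cutNearOrigin, abs_mul, abs_of_nonneg (outerCutoff_nonneg _)]
  exact mul_le_of_le_one_left (abs_nonneg _) (outerCutoff_le_one _)

lemma cutNearOrigin_eventuallyEq (hR : 0 < R) {x : EuclideanSpace ℝ (Fin n)}
    (hx : 2 < R * ‖x‖) : cutNearOrigin R φ =ᶠ[nhds x] φ := by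
  have h : 2 < ‖R • x‖ := by rwa [norm_smul, Real.norm_of_nonneg hR.le]
  have := (continuous_const_smul R).continuousAt.eventually (outerCutoff_eventuallyEq_one h)
  filter_upwards [this] with y hy
  simp [cutNearOrigin, hy]

lemma norm_gradient_cutNearOrigin_sq_le {M : ℝ}
    (hM : ∀ y : EuclideanSpace ℝ (Fin n), ‖gradient outerCutoff y‖ * ‖y‖ ≤ M)
    (hφ : ContDiff ℝ 1 φ) (R : ℝ) {x : EuclideanSpace ℝ (Fin n)} (hx : 0 < ‖x‖) :
    ‖gradient (cutNearOrigin R φ) x‖ ^ 2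
      ≤ 2 * ‖gradient φ x‖ ^ 2 + 2 * M ^ 2 * (φ x ^ 2 / ‖x‖ ^ 2) := by
  have hg : HasFDerivAt (fun y : EuclideanSpace ℝ (Fin n) => outerCutoff (R • y))
      (R • fderiv ℝ outerCutoff (R • x)) x := by
    have h1 := (contDiff_outerCutoff.differentiable one_ne_zero (R • x)).hasFDerivAt.comp x
      ((hasFDerivAt_id x).const_smul R)
    convert! h1 using 1
    ext; simp
  have h := hg.fun_mul (hφ.differentiable one_ne_zero x).hasFDerivAt
  have hle : ‖gradient (cutNearOrigin R φ) x‖ ≤ ‖gradient φ x‖ + M * (|φ x| / ‖x‖) := by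
    rw [norm_gradient, norm_gradient]
    unfold cutNearOrigin
    rw [h.fderiv]
    refine (norm_add_le _ _).trans (add_le_add ?_ ?_)
    · rw [norm_smul, Real.norm_of_nonneg (outerCutoff_nonneg _)]
      exact mul_le_of_le_one_left (norm_nonneg _) (outerCutoff_le_one _)
    · have h2 := hM (R • x)
      rw [norm_gradient, norm_smul] at h2
      rw [norm_smul, norm_smul, Real.norm_eq_abs, ← mul_div_assoc, le_div_iff₀ hx]
      nlinarith [mul_le_mul_of_nonneg_right h2 (abs_nonneg (φ x))]
  have hnn : 0 ≤ ‖gradient (cutNearOrigin R φ) x‖ := norm_nonneg _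
  calc _ ≤ (‖gradient φ x‖ + M * (|φ x| / ‖x‖)) ^ 2 := by gcongr
    _ ≤ 2 * ‖gradient φ x‖ ^ 2 + 2 * (M * (|φ x| / ‖x‖)) ^ 2 := by
      nlinarith [sq_nonneg (‖gradient φ x‖ - M * (|φ x| / ‖x‖))]
    _ = _ := by rw [mul_pow, div_pow, sq_abs]; ring

lemma eventually_cutNearOrigin_eventuallyEq (φ : EuclideanSpace ℝ (Fin n) → ℝ)
    {x : EuclideanSpace ℝ (Fin n)} (hx : 0 < ‖x‖) :
    ∀ᶠ k : ℕ in Filter.atTop, cutNearOrigin ((k : ℝ) + 1) φ =ᶠ[nhds x] φ := by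
  have h : Filter.Tendsto (fun k : ℕ => ((k : ℝ) + 1) * ‖x‖) Filter.atTop Filter.atTop :=
    (Filter.tendsto_atTop_add_const_right _ _ tendsto_natCast_atTop_atTop).atTop_mul_const hx
  filter_upwards [h.eventually_gt_atTop 2] with k hk
  exact cutNearOrigin_eventuallyEq (by positivity) hk


lemma norm_lt_one_of_mem_tsupport (hs : tsupport φ ⊆ Metric.ball 0 1)
    {x : EuclideanSpace ℝ (Fin n)} (hx : x ∈ tsupport φ) : ‖x‖ < 1 := by
  simpa using hs hx

lemma dH_rpow_mul_gradient_cutNearOrigin_sq_le {M : ℝ}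
    (hM : ∀ y : EuclideanSpace ℝ (Fin n), ‖gradient outerCutoff y‖ * ‖y‖ ≤ M)
    (hφ : ContDiff ℝ 1 φ) (R α s : ℝ) {x : EuclideanSpace ℝ (Fin n)} (hx : 0 < ‖x‖)
    (hx1 : ‖x‖ < 1) :
    dH x ^ α * ‖gradient (cutNearOrigin R φ) x‖ ^ 2 * lam x ^ (s - 2)
      ≤ 2 * (dH x ^ α * ‖gradient φ x‖ ^ 2 * lam x ^ (s - 2))
        + 2 * M ^ 2 * (dH x ^ (α - 2) * φ x ^ 2 * lam x ^ s) := by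
  have hd : 0 < dH x := radialDist_pos hx hx1
  have hl : 0 < lam x := radialConf_pos hx.le hx1
  have hle : dH x ≤ lam x * ‖x‖ := radialDist_le hx.le hx1
  have hsq : dH x ^ 2 / ‖x‖ ^ 2 ≤ lam x ^ 2 := by
    rw [div_le_iff₀ (by positivity), ← mul_pow]
    gcongr
  have ed : dH x ^ α = dH x ^ (α - 2) * dH x ^ 2 := by
    rw [← Real.rpow_natCast, ← Real.rpow_add hd]
    norm_num
  have el : lam x ^ s = lam x ^ (s - 2) * lam x ^ 2 := by
    rw [← Real.rpow_natCast, ← Real.rpow_add hl]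
    norm_num
  calc _ ≤ dH x ^ α * (2 * ‖gradient φ x‖ ^ 2 + 2 * M ^ 2 * (φ x ^ 2 / ‖x‖ ^ 2))
        * lam x ^ (s - 2) := by
        gcongr
        exact norm_gradient_cutNearOrigin_sq_le hM hφ R hx
    _ = 2 * (dH x ^ α * ‖gradient φ x‖ ^ 2 * lam x ^ (s - 2)) +
        2 * M ^ 2 * (dH x ^ (α - 2) * φ x ^ 2 * lam x ^ (s - 2) * (dH x ^ 2 / ‖x‖ ^ 2)) := by
        rw [ed]; ring
    _ ≤ 2 * (dH x ^ α * ‖gradient φ x‖ ^ 2 * lam x ^ (s - 2)) +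
        2 * M ^ 2 * (dH x ^ (α - 2) * φ x ^ 2 * lam x ^ (s - 2) * lam x ^ 2) := by
        gcongr
    _ = _ := by rw [el]; ring

lemma tendsto_integral_cutNearOrigin_sq (hn : 0 < n) {s : ℝ} (hs : -(n : ℝ) < s) (t : ℝ)
    (hφ : ContDiff ℝ 1 φ) (hc : HasCompactSupport φ) (hsupp : tsupport φ ⊆ Metric.ball 0 1) :
    Filter.Tendsto (fun k : ℕ => ∫ x, dH x ^ s * cutNearOrigin ((k : ℝ) + 1) φ x ^ 2 * lam x ^ t)
      Filter.atTop (nhds (∫ x, dH x ^ s * φ x ^ 2 * lam x ^ t)) := by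
  refine tendsto_integral_of_dominated_convergence _
    (fun k => (measurable_dH_rpow_mul ((contDiff_cutNearOrigin hφ).continuous.pow 2)
      s t).aestronglyMeasurable)
    (integrable_dH_rpow_mul hn hs (t := t) hc hsupp (hφ.continuous.pow 2)
      fun x hx => by simp [image_eq_zero_of_notMem_tsupport hx]) (fun k => ?_) ?_
  · refine Filter.Eventually.of_forall fun x => ?_
    by_cases hx : x ∈ tsupport φ
    · have hx1 := norm_lt_one_of_mem_tsupport hsupp hx
      have hd := dH_nonneg hx1
      have hl : 0 < lam x := radialConf_pos (norm_nonneg x) hx1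
      have h := sq_le_sq.2 (abs_cutNearOrigin_le ((k : ℝ) + 1) φ x)
      rw [Real.norm_of_nonneg (by positivity)]
      gcongr
      exact h
    · simp [cutNearOrigin, image_eq_zero_of_notMem_tsupport hx]
  · filter_upwards [ae_norm_pos hn] with x hx
    refine tendsto_const_nhds.congr' ?_
    filter_upwards [eventually_cutNearOrigin_eventuallyEq φ hx] with k hk
    rw [hk.eq_of_nhds]

lemma tendsto_integral_cutNearOrigin_rpow (hn : 0 < n) {s : ℝ} (hs : -(n : ℝ) < s) {q : ℝ}
    (hq : 0 < q) (hφ : ContDiff ℝ 1 φ) (hc : HasCompactSupport φ)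
    (hsupp : tsupport φ ⊆ Metric.ball 0 1) :
    Filter.Tendsto (fun k : ℕ => ∫ x, dH x ^ s * |cutNearOrigin ((k : ℝ) + 1) φ x| ^ q)
      Filter.atTop (nhds (∫ x, dH x ^ s * |φ x| ^ q)) := by
  have hcont {f : EuclideanSpace ℝ (Fin n) → ℝ} (hf : ContDiff ℝ 1 f) :
      Continuous fun x => |f x| ^ q := hf.continuous.abs.rpow_const fun _ => Or.inr hq.le
  have hint := integrable_dH_rpow_mul hn hs (t := 0) hc hsupp (hcont hφ)
    fun x hx => by simp [image_eq_zero_of_notMem_tsupport hx, Real.zero_rpow hq.ne']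
  simp only [Real.rpow_zero, mul_one] at hint
  refine tendsto_integral_of_dominated_convergence _ (fun k => ?_) hint (fun k => ?_) ?_
  · simpa using (measurable_dH_rpow_mul (hcont (contDiff_cutNearOrigin (R := (k : ℝ) + 1) hφ))
      s 0).aestronglyMeasurable (μ := volume)
  · refine Filter.Eventually.of_forall fun x => ?_
    by_cases hx : x ∈ tsupport φ
    · have hd := dH_nonneg (norm_lt_one_of_mem_tsupport hsupp hx)
      rw [Real.norm_of_nonneg (by positivity)]
      exact mul_le_mul_of_nonneg_left (Real.rpow_le_rpow (abs_nonneg _)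
        (abs_cutNearOrigin_le _ φ x) hq.le) (by positivity)
    · simp [cutNearOrigin, image_eq_zero_of_notMem_tsupport hx, Real.zero_rpow hq.ne']
  · filter_upwards [ae_norm_pos hn] with x hx
    refine tendsto_const_nhds.congr' ?_
    filter_upwards [eventually_cutNearOrigin_eventuallyEq φ hx] with k hk
    rw [hk.eq_of_nhds]

lemma tendsto_integral_gradient_cutNearOrigin_sq (hn : 0 < n) {s : ℝ} (hs : -(n : ℝ) < s - 2)
    (t : ℝ) (hφ : ContDiff ℝ 1 φ) (hc : HasCompactSupport φ)
    (hsupp : tsupport φ ⊆ Metric.ball 0 1) :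
    Filter.Tendsto (fun k : ℕ =>
        ∫ x, dH x ^ s * ‖gradient (cutNearOrigin ((k : ℝ) + 1) φ) x‖ ^ 2 * lam x ^ (t - 2))
      Filter.atTop (nhds (∫ x, dH x ^ s * ‖gradient φ x‖ ^ 2 * lam x ^ (t - 2))) := by
  obtain ⟨M, hM⟩ := exists_norm_gradient_outerCutoff_mul_le (n := n)
  have hg := (integrable_dH_rpow_mul hn (by linarith : -(n : ℝ) < s) (t := t - 2) hc hsupp
    ((continuous_gradient hφ).norm.pow 2)
    fun x hx => by simp [gradient_eq_zero_of_notMem_tsupport hx]).const_mul 2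
  have hv := (integrable_dH_rpow_mul hn hs (t := t) hc hsupp (hφ.continuous.pow 2)
    fun x hx => by simp [image_eq_zero_of_notMem_tsupport hx]).const_mul (2 * M ^ 2)
  refine tendsto_integral_of_dominated_convergence _
    (fun k => (measurable_dH_rpow_mul
      ((continuous_gradient (contDiff_cutNearOrigin hφ)).norm.pow 2) s _).aestronglyMeasurable)
    (hg.add hv) (fun k => ?_) ?_
  · filter_upwards [ae_norm_pos hn] with x hx0
    by_cases hx : x ∈ tsupport φ
    · have hx1 := norm_lt_one_of_mem_tsupport hsupp hx
      have hd := dH_nonneg hx1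
      have hl : 0 < lam x := radialConf_pos (norm_nonneg x) hx1
      rw [Real.norm_of_nonneg (by positivity)]
      exact dH_rpow_mul_gradient_cutNearOrigin_sq_le hM hφ _ s t hx0 hx1
    · have hx' := fun h => hx (tsupport_cutNearOrigin_subset ((k : ℝ) + 1) φ h)
      simp [gradient_eq_zero_of_notMem_tsupport hx, gradient_eq_zero_of_notMem_tsupport hx',
        image_eq_zero_of_notMem_tsupport hx]
  · filter_upwards [ae_norm_pos hn] with x hx
    refine tendsto_const_nhds.congr' ?_
    filter_upwards [eventually_cutNearOrigin_eventuallyEq φ hx] with k hk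
    rw [norm_gradient, norm_gradient, hk.fderiv_eq]

end Approximation

/-- The Hardy inequality with Sobolev remainder in the full range `2 ≤ q ≤ 2 * n / (n - 2)`, with all
integrals taken over the whole space. -/
lemma exists_hardy_sobolev_of_tsupport_subset_ball {n : ℕ} (hn : 2 < n) (α : ℝ)
    (hα : 0 < (n : ℝ) + α - 2) {q : ℝ} (hq2 : 2 ≤ q) (hq : q ≤ 2 * n / ((n : ℝ) - 2)) :
    ∃ c > (0 : ℝ), ∀ φ : EuclideanSpace ℝ (Fin n) → ℝ,
      ContDiff ℝ 1 φ → HasCompactSupport φ → tsupport φ ⊆ Metric.ball 0 1 →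
      (((n : ℝ) + α - 2) / 2) ^ 2 * (∫ x, dH x ^ (α - 2) * φ x ^ 2 * lam x ^ (n : ℝ)) +
          c * (∫ x, dH x ^ ((((n : ℝ) - 2) * (q - 2) + α * q) / 2) * |φ x| ^ q) ^ (2 / q) ≤
        ∫ x, dH x ^ α * ‖gradient φ x‖ ^ 2 * lam x ^ ((n : ℝ) - 2) := by
  obtain ⟨c, hc0, h⟩ := hardy_sobolev_of_tsupport_subset_puncturedBall hn α hα hq2 hq
  refine ⟨c, hc0, fun φ hφ hc hs => ?_⟩
  have hq0 : 0 < q := by linarith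
  have hn0 : 0 < n := by omega
  have he : -(n : ℝ) < (((n : ℝ) - 2) * (q - 2) + α * q) / 2 := by
    nlinarith [mul_pos hq0 hα]
  have hJ := tendsto_integral_cutNearOrigin_sq hn0 (by linarith : -(n : ℝ) < α - 2) n hφ hc hs
  have hS := (tendsto_integral_cutNearOrigin_rpow hn0 he hq0 hφ hc hs).rpow_const
    (p := 2 / q) (Or.inr (by positivity))
  have hI := tendsto_integral_gradient_cutNearOrigin_sq hn0 (by linarith : -(n : ℝ) < α - 2) n
    hφ hc hs
  refine le_of_tendsto_of_tendsto' ((hJ.const_mul _).add (hS.const_mul c)) hI fun k => ?_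
  exact h _ (contDiff_cutNearOrigin hφ) (hc.mul_left)
    (tsupport_cutNearOrigin_subset_puncturedBall (by positivity) hs)

/-- Improved Hardy inequality on ℍⁿ with a weighted Sobolev remainder term (Theorem 2.4). -/
theorem hardy_hyperbolic_sobolev_remainder {n : ℕ} (hn : 2 < n)
    (α : ℝ) (hα : 0 < (n : ℝ) + α - 2) :
    ∃ ε > (0 : ℝ), ∀ q : ℝ, 2 ≤ q → q ≤ 2 * n / ((n : ℝ) - 1) + 2 * ε →
      ∃ c > (0 : ℝ), ∀ φ : EuclideanSpace ℝ (Fin n) → ℝ,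
        ContDiff ℝ (⊤ : ℕ∞) φ → HasCompactSupport φ →
        tsupport φ ⊆ Metric.ball (0 : EuclideanSpace ℝ (Fin n)) 1 →
        (((n : ℝ) + α - 2) / 2) ^ 2 *
              (∫ x in Metric.ball (0 : EuclideanSpace ℝ (Fin n)) 1,
                dH x ^ (α - 2) * φ x ^ 2 * lam x ^ (n : ℝ)) +
            c * (∫ x in Metric.ball (0 : EuclideanSpace ℝ (Fin n)) 1,
                dH x ^ ((((n : ℝ) - 2) * (q - 2) + α * q) / 2) * |φ x| ^ q) ^ (2 / q) ≤
          ∫ x in Metric.ball (0 : EuclideanSpace ℝ (Fin n)) 1,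
            dH x ^ α * ‖gradient φ x‖ ^ 2 * lam x ^ ((n : ℝ) - 2) := by
  have hn3 : (3 : ℝ) ≤ n := by exact_mod_cast hn
  refine ⟨n / (((n : ℝ) - 1) * (n - 2)), div_pos (by linarith) (mul_pos (by linarith)
    (by linarith)), fun q hq2 hq => ?_⟩
  have hq' : q ≤ 2 * n / ((n : ℝ) - 2) := by
    refine hq.trans_eq ?_
    have h1 : (n : ℝ) - 1 ≠ 0 := by linarith
    have h2 : (n : ℝ) - 2 ≠ 0 := by linarith
    field_simp
    ring
  obtain ⟨c, hc0, h⟩ := exists_hardy_sobolev_of_tsupport_subset_ball hn α hα hq2 hq'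
  refine ⟨c, hc0, fun φ hφ hc hs => ?_⟩
  have hq0 : q ≠ 0 := by linarith
  have hout {x} (hx : x ∉ Metric.ball (0 : EuclideanSpace ℝ (Fin n)) 1) : x ∉ tsupport φ :=
    fun hx' => hx (hs hx')
  rw [setIntegral_eq_integral_of_forall_compl_eq_zero fun x hx => by
      simp [image_eq_zero_of_notMem_tsupport (hout hx)],
    setIntegral_eq_integral_of_forall_compl_eq_zero fun x hx => by
      simp [image_eq_zero_of_notMem_tsupport (hout hx), Real.zero_rpow hq0],
    setIntegral_eq_integral_of_forall_compl_eq_zero fun x hx => by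
      simp [gradient_eq_zero_of_notMem_tsupport (hout hx)]]
  exact h φ (hφ.of_le (by exact_mod_cast le_top)) hc hs
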